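/- The restriction embedding of Thompson's group F into Thompson's group V is a quasi-isometric embedding: for every finite generating set S of V there exists a constant C ≥ 1 such that for every f ∈ F (identified with its restriction to [0,1), an element of V), one has (1/C)·ℓ(f) ≤ ℓ_S(f) ≤ C·ℓ(f), where ℓ is word length in F with respect to {x₀, x₁} and ℓ_S is word length in V with respect to S. -/

import Mathlib

noncomputable section

open Set

noncomputable section

open Set

def x0fun : ℝ → ℝ := fun t =>
  if t < 0 then t
  else if t ≤ 1/2 then t / 2
  else if t ≤ 3/4 then t - 1/4
  else if t ≤ 1 then 2 * t - 1
  else t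

def x0inv : ℝ → ℝ := fun t =>
  if t < 0 then t
  else if t ≤ 1/4 then 2 * t
  else if t ≤ 1/2 then t + 1/4
  else if t ≤ 1 then (t + 1) / 2
  else t

/-- The generator `x₀` of Thompson's group `F`, as a permutation of `ℝ`
(the identity outside `[0,1]`). -/
def x0 : Equiv.Perm ℝ where
  toFun := x0fun
  invFun := x0inv
  left_inv := by
    intro t
    show x0inv (x0fun t) = t
    unfold x0fun
    split_ifs <;> (unfold x0inv; split_ifs <;> linarith)
  right_inv := by
    intro t
    show x0fun (x0inv t) = t
    unfold x0inv
    split_ifs <;> (unfold x0fun; split_ifs <;> linarith)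

def x1fun : ℝ → ℝ := fun t =>
  if t < 0 then t
  else if t ≤ 1/2 then t
  else if t ≤ 3/4 then t / 2 + 1/4
  else if t ≤ 7/8 then t - 1/8
  else if t ≤ 1 then 2 * t - 1
  else t

def x1inv : ℝ → ℝ := fun t =>
  if t < 0 then t
  else if t ≤ 1/2 then t
  else if t ≤ 5/8 then 2 * t - 1/2
  else if t ≤ 3/4 then t + 1/8
  else if t ≤ 1 then (t + 1) / 2
  else t

set_option maxHeartbeats 2000000 in
/-- The generator `x₁` of Thompson's group `F`, as a permutation of `ℝ`
(the identity outside `[0,1]`). -/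
def x1 : Equiv.Perm ℝ where
  toFun := x1fun
  invFun := x1inv
  left_inv := by
    intro t
    show x1inv (x1fun t) = t
    unfold x1fun
    split_ifs <;> (unfold x1inv; split_ifs <;> linarith)
  right_inv := by
    intro t
    show x1fun (x1inv t) = t
    unfold x1inv
    split_ifs <;> (unfold x1fun; split_ifs <;> linarith)

/-- Thompson's group `F`: the subgroup generated by `x₀` and `x₁`. -/
def ThompsonF : Subgroup (Equiv.Perm ℝ) :=
  Subgroup.closure ({x0, x1} : Set (Equiv.Perm ℝ))

/-- Word length with respect to the generating set `{x₀, x₁}`. -/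
def wordLength (f : Equiv.Perm ℝ) : ℕ :=
  sInf {n | ∃ w : List (Equiv.Perm ℝ), w.length = n ∧
    (∀ g ∈ w, g ∈ ({x0, x1, x0⁻¹, x1⁻¹} : Set (Equiv.Perm ℝ))) ∧ w.prod = f}
/-- `a` and `b` are the endpoints of a standard dyadic interval `[k/2^m, (k+1)/2^m]`. -/
def IsStdDyadicPair (a b : ℝ) : Prop :=
  ∃ k m : ℕ, a = (k : ℝ) / 2 ^ m ∧ b = ((k : ℝ) + 1) / 2 ^ m

/-- Membership in Thompson's group `V`, realized as permutations of `ℝ` that are the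
identity outside `[0,1)`: there are partitions of `[0,1)` into standard dyadic intervals
`[a_{i−1}, a_i)` and `[b_{i−1}, b_i)` and a permutation `σ` such that `v` maps
`[a_{i−1}, a_i)` onto `[b_{σ(i)−1}, b_{σ(i)})` by an increasing affine map. -/
def MemV (v : Equiv.Perm ℝ) : Prop :=
  (∀ t, t ∉ Set.Ico (0:ℝ) 1 → v t = t) ∧
  ∃ N : ℕ, ∃ a b : Fin (N + 1) → ℝ, ∃ σ : Equiv.Perm (Fin N),
    a 0 = 0 ∧ a (Fin.last N) = 1 ∧ b 0 = 0 ∧ b (Fin.last N) = 1 ∧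
    StrictMono a ∧ StrictMono b ∧
    ∀ i : Fin N, IsStdDyadicPair (a i.castSucc) (a i.succ) ∧
      IsStdDyadicPair (b i.castSucc) (b i.succ) ∧
      ∃ c d : ℝ, 0 < c ∧
        (∀ t ∈ Set.Ico (a i.castSucc) (a i.succ), v t = c * t + d) ∧
        c * a i.castSucc + d = b (σ i).castSucc ∧ c * a i.succ + d = b (σ i).succ

/-- Word length with respect to a set `S` (products of elements of `S ∪ S⁻¹`). -/
def wordLengthWith (S : Set (Equiv.Perm ℝ)) (v : Equiv.Perm ℝ) : ℕ :=
  sInf {n | ∃ w : List (Equiv.Perm ℝ), w.length = n ∧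
    (∀ g ∈ w, g ∈ S ∨ g⁻¹ ∈ S) ∧ w.prod = v}

/-- `S` is a finite generating set of Thompson's group `V`. -/
def GeneratesV (S : Set (Equiv.Perm ℝ)) : Prop :=
  S.Finite ∧ (∀ s ∈ S, MemV s) ∧
  ∀ v, MemV v → ∃ w : List (Equiv.Perm ℝ), (∀ g ∈ w, g ∈ S ∨ g⁻¹ ∈ S) ∧ w.prod = v


/-! ### Binary words and standard dyadic intervals -/

/-- The increasing affine map from `[0,1)` onto the standard dyadic interval with binary
address `w`. -/
def dyadicMap : List Bool → ℝ → ℝ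
  | [], s => s
  | b :: w, s => ((if b then 1 else 0) + dyadicMap w s) / 2

lemma dyadicMap_append (u w : List Bool) (s : ℝ) :
    dyadicMap (u ++ w) s = dyadicMap u (dyadicMap w s) := by
  induction u with
  | nil => rfl
  | cons b u ih => simp [dyadicMap, ih]

lemma dyadicMap_mem (w : List Bool) {s : ℝ} (hs : s ∈ Ico (0 : ℝ) 1) :
    dyadicMap w s ∈ Ico (0 : ℝ) 1 := by
  induction w with
  | nil => exact hs
  | cons b w ih =>
    obtain ⟨h0, h1⟩ := ih
    cases b <;> simp only [dyadicMap] <;> constructor <;> norm_num <;> linarith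

lemma zero_mem_unit : (0 : ℝ) ∈ Ico (0 : ℝ) 1 := by norm_num

/-- Overlapping standard dyadic intervals are nested. -/
lemma prefix_or_prefix_of_dyadicMap_eq (u w : List Bool) {s t : ℝ} (hs : s ∈ Ico (0 : ℝ) 1)
    (ht : t ∈ Ico (0 : ℝ) 1) (h : dyadicMap u s = dyadicMap w t) : u <+: w ∨ w <+: u := by
  induction u generalizing w with
  | nil => exact Or.inl List.nil_prefix
  | cons b u ih =>
    cases w with
    | nil => exact Or.inr List.nil_prefix
    | cons c w =>
      obtain ⟨h0, h1⟩ := dyadicMap_mem u hs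
      obtain ⟨h2, h3⟩ := dyadicMap_mem w ht
      have hbc : b = c := by
        cases b <;> cases c <;> simp only [dyadicMap] at h <;> first | rfl | skip
        all_goals (norm_num at h; linarith)
      subst hbc
      have h' : dyadicMap u s = dyadicMap w t := by
        simp only [dyadicMap] at h
        linarith
      simpa using ih w h'

lemma dyadicMap_eq_add (w : List Bool) (s : ℝ) :
    dyadicMap w s = dyadicMap w 0 + s / 2 ^ w.length := by
  induction w with
  | nil => simp [dyadicMap]
  | cons b w ih =>
    simp only [dyadicMap, List.length_cons, pow_succ]
    rw [ih]
    field_simp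
    ring

lemma dyadicMap_word_injective {u w : List Bool}
    (h : ∀ s ∈ Ico (0 : ℝ) 1, dyadicMap u s = dyadicMap w s) : u = w := by
  have h0 := h 0 zero_mem_unit
  have h1 := h (1 / 2) (by norm_num)
  rw [dyadicMap_eq_add u, dyadicMap_eq_add w, h0] at h1
  have h2 : (2 : ℝ) ^ u.length = 2 ^ w.length := by
    have : (1 / 2 : ℝ) / 2 ^ u.length = 1 / 2 / 2 ^ w.length := by linarith
    field_simp at this
    exact this.symm
  have hlen : u.length = w.length := pow_right_injective₀ (by norm_num) (by norm_num) h2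
  rcases prefix_or_prefix_of_dyadicMap_eq u w zero_mem_unit zero_mem_unit h0 with h | h
  · exact h.eq_of_length hlen
  · exact (h.eq_of_length hlen.symm).symm

lemma exists_dyadicMap_of_lt (m k : ℕ) (hk : k < 2 ^ m) :
    ∃ w : List Bool, ∀ s : ℝ, dyadicMap w s = ((k : ℝ) + s) / 2 ^ m := by
  induction m generalizing k with
  | zero =>
    have : k = 0 := by simpa using hk
    exact ⟨[], fun s => by simp [dyadicMap, this]⟩
  | succ m ih =>
    rcases lt_or_ge k (2 ^ m) with h | h
    · obtain ⟨w, hw⟩ := ih k h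
      refine ⟨false :: w, fun s => ?_⟩
      simp only [dyadicMap, hw, pow_succ]
      field_simp
      norm_num
    · obtain ⟨w, hw⟩ := ih (k - 2 ^ m) (by rw [pow_succ] at hk; omega)
      refine ⟨true :: w, fun s => ?_⟩
      simp only [dyadicMap, hw, pow_succ]
      rw [Nat.cast_sub h]
      push_cast
      field_simp
      ring

lemma IsStdDyadicPair.exists_dyadicMap {a b : ℝ} (h : IsStdDyadicPair a b) (hb : b ≤ 1) :
    ∃ w : List Bool, ∀ s : ℝ, dyadicMap w s = a + s * (b - a) := by
  obtain ⟨k, m, rfl, rfl⟩ := h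
  have hk : k < 2 ^ m := by
    rw [div_le_one (by positivity)] at hb
    have : k + 1 ≤ 2 ^ m := by exact_mod_cast hb
    omega
  obtain ⟨w, hw⟩ := exists_dyadicMap_of_lt m k hk
  refine ⟨w, fun s => ?_⟩
  rw [hw]
  ring

/-! ### Permutations mapping one standard dyadic interval onto another -/

/-- `v` maps the dyadic interval with address `u` affinely onto the one with address `w`. -/
def MapsWord (v : Equiv.Perm ℝ) (u w : List Bool) : Prop :=
  ∀ s ∈ Ico (0 : ℝ) 1, v (dyadicMap u s) = dyadicMap w s

namespace MapsWord

variable {g h : Equiv.Perm ℝ} {u v w : List Bool}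

lemma one (u : List Bool) : MapsWord 1 u u := fun _ _ => rfl

lemma append (hg : MapsWord g u w) (x : List Bool) : MapsWord g (u ++ x) (w ++ x) := by
  intro s hs
  rw [dyadicMap_append, dyadicMap_append, hg _ (dyadicMap_mem x hs)]

lemma mul (hg : MapsWord g v w) (hh : MapsWord h u v) : MapsWord (g * h) u w := by
  intro s hs
  rw [Equiv.Perm.mul_apply, hh s hs, hg s hs]

lemma inv (hg : MapsWord g u w) : MapsWord g⁻¹ w u := by
  intro s hs
  rw [← hg s hs]
  exact g.symm_apply_apply _

lemma target_unique (hv : MapsWord g u v) (hw : MapsWord g u w) : v = w :=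
  dyadicMap_word_injective fun s hs => (hv s hs).symm.trans (hw s hs)

lemma source_unique (hu : MapsWord g u w) (hv : MapsWord g v w) : u = v :=
  hu.inv.target_unique hv.inv

end MapsWord

/-- `v` maps the dyadic interval with address `u` affinely onto some standard dyadic
interval. -/
def GoodWord (v : Equiv.Perm ℝ) (u : List Bool) : Prop := ∃ w, MapsWord v u w

/-- The addresses of the dyadic intervals that `v` does not map affinely onto a standard dyadic
interval. -/
def badWords (v : Equiv.Perm ℝ) : Set (List Bool) := {u | ¬ GoodWord v u}

lemma badWords_one : badWords 1 = ∅ := by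
  ext u
  simp only [badWords, mem_ofPred_eq, mem_empty_iff_false, iff_false, not_not]
  exact ⟨u, MapsWord.one u⟩

lemma encard_badWords_mul_le (g h : Equiv.Perm ℝ) :
    (badWords (g * h)).encard ≤ (badWords g).encard + (badWords h).encard := by
  classical
  have hsub : badWords (g * h) ⊆ {u | ∃ w, MapsWord h u w ∧ w ∈ badWords g} ∪ badWords h := by
    intro u hu
    by_cases hh : GoodWord h u
    · obtain ⟨w, hw⟩ := hh
      exact Or.inl ⟨w, hw, fun ⟨z, hz⟩ => hu ⟨z, hz.mul hw⟩⟩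
    · exact Or.inr hh
  refine (encard_le_encard hsub).trans ((encard_union_le _ _).trans (add_le_add_left ?_ _))
  let φ : List Bool → List Bool := fun u => if hu : GoodWord h u then hu.choose else []
  have hφ : ∀ u, GoodWord h u → MapsWord h u (φ u) := by
    intro u hu
    simp only [φ, dif_pos hu]
    exact hu.choose_spec
  refine encard_le_encard_of_injOn (f := φ) ?_ ?_
  · rintro u ⟨w, hw, hbad⟩
    rwa [(hφ u ⟨w, hw⟩).target_unique hw]
  · rintro u ⟨w, hw, -⟩ u' ⟨w', hw', -⟩ heq
    have h1 := hφ u ⟨w, hw⟩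
    rw [heq] at h1
    exact h1.source_unique (hφ u' ⟨w', hw'⟩)

lemma encard_badWords_prod_le {K : ℕ} (w : List (Equiv.Perm ℝ))
    (hw : ∀ g ∈ w, (badWords g).encard ≤ K) :
    (badWords w.prod).encard ≤ (w.length * K : ℕ) := by
  induction w with
  | nil => simp [badWords_one]
  | cons g w ih =>
    rw [List.prod_cons]
    refine (encard_badWords_mul_le _ _).trans ?_
    refine (add_le_add (hw g (by simp)) (ih fun g hg => hw g (by simp [hg]))).trans ?_
    rw [List.length_cons, ← Nat.cast_add]
    exact Nat.cast_le.2 (by ring_nf; rfl)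

lemma finite_badWords_of_cover {v : Equiv.Perm ℝ} {P : Set (List Bool)} (hP : P.Finite)
    (hgood : ∀ p ∈ P, GoodWord v p)
    (hcover : ∀ t ∈ Ico (0 : ℝ) 1, ∃ p ∈ P, ∃ s ∈ Ico (0 : ℝ) 1, t = dyadicMap p s) :
    (badWords v).Finite := by
  obtain ⟨D, hD⟩ := (hP.image List.length).bddAbove
  refine (List.finite_length_lt Bool D).subset fun u hu => ?_
  by_contra hlen
  have hlen : D ≤ u.length := not_lt.1 hlen
  obtain ⟨p, hpP, s, hs, hps⟩ := hcover _ (dyadicMap_mem u zero_mem_unit)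
  have hpD : p.length ≤ D := hD (mem_image_of_mem _ hpP)
  have hpre : p <+: u := by
    rcases prefix_or_prefix_of_dyadicMap_eq u p zero_mem_unit hs hps with h | h
    · rw [h.eq_of_length_le (hpD.trans hlen)]
    · exact h
  obtain ⟨x, rfl⟩ := hpre
  obtain ⟨w, hw⟩ := hgood p hpP
  exact hu ⟨w ++ x, hw.append x⟩

lemma exists_partition_interval {N : ℕ} {a : Fin (N + 1) → ℝ} (h0 : a 0 = 0)
    (h1 : a (Fin.last N) = 1) {t : ℝ} (ht : t ∈ Ico (0 : ℝ) 1) :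
    ∃ i : Fin N, t ∈ Ico (a i.castSucc) (a i.succ) := by
  by_contra! hno
  have hle : ∀ i, a i ≤ t := by
    intro i
    induction i using Fin.induction with
    | zero => rw [h0]; exact ht.1
    | succ i ih => exact not_lt.1 fun hlt => hno i ⟨ih, hlt⟩
  have := hle (Fin.last N)
  rw [h1] at this
  exact absurd ht.2 (not_lt.2 this)

lemma partition_cover {N : ℕ} {a : Fin (N + 1) → ℝ} (h0 : a 0 = 0)
    (h1 : a (Fin.last N) = 1) (p : Fin N → List Bool)
    (hp : ∀ i s, dyadicMap (p i) s = a i.castSucc + s * (a i.succ - a i.castSucc))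
    {t : ℝ} (ht : t ∈ Ico (0 : ℝ) 1) :
    ∃ q ∈ range p, ∃ s ∈ Ico (0 : ℝ) 1, t = dyadicMap q s := by
  obtain ⟨i, hi0, hi1⟩ := exists_partition_interval h0 h1 ht
  have hpos : 0 < a i.succ - a i.castSucc := by linarith
  refine ⟨p i, mem_range_self i, (t - a i.castSucc) / (a i.succ - a i.castSucc), ⟨?_, ?_⟩, ?_⟩
  · exact div_nonneg (by linarith) hpos.le
  · rw [div_lt_one hpos]
    linarith
  · rw [hp, div_mul_cancel₀ _ hpos.ne']
    ring

lemma MemV.finite_badWords {v : Equiv.Perm ℝ} (hv : MemV v) :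
    (badWords v).Finite ∧ (badWords v⁻¹).Finite := by
  obtain ⟨-, N, a, b, σ, ha0, ha1, hb0, hb1, ha, hb, hi⟩ := hv
  have hp : ∀ i : Fin N, ∃ w : List Bool, ∀ s : ℝ,
      dyadicMap w s = a i.castSucc + s * (a i.succ - a i.castSucc) := fun i =>
    (hi i).1.exists_dyadicMap (ha1 ▸ ha.monotone (Fin.le_last _))
  have hq : ∀ i : Fin N, ∃ w : List Bool, ∀ s : ℝ,
      dyadicMap w s = b i.castSucc + s * (b i.succ - b i.castSucc) := fun i =>
    (hi i).2.1.exists_dyadicMap (hb1 ▸ hb.monotone (Fin.le_last _))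
  choose p hp using hp
  choose q hq using hq
  have hmaps : ∀ i, MapsWord v (p i) (q (σ i)) := by
    intro i s hs
    obtain ⟨-, -, c, d, -, hcd, h0, h1⟩ := hi i
    have hlt : a i.castSucc < a i.succ := ha i.castSucc_lt_succ
    have hs' : s * (a i.succ - a i.castSucc) < a i.succ - a i.castSucc := by
      nlinarith [hs.2]
    have hs'' : 0 ≤ s * (a i.succ - a i.castSucc) := mul_nonneg hs.1 (by linarith)
    rw [hp, hq, hcd _ ⟨by linarith, by linarith⟩, ← h0, ← h1]
    ring
  constructor
  · refine finite_badWords_of_cover (finite_range p) ?_ fun t ht => partition_cover ha0 ha1 p hp ht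
    rintro _ ⟨i, rfl⟩
    exact ⟨_, hmaps i⟩
  · refine finite_badWords_of_cover (finite_range q) ?_ fun t ht => partition_cover hb0 hb1 q hq ht
    rintro _ ⟨i, rfl⟩
    have h := (hmaps (σ.symm i)).inv
    rw [Equiv.apply_symm_apply] at h
    exact ⟨_, h⟩

/-! ### Binary trees -/

/-- Finite rooted binary trees. -/
inductive CaretTree : Type
  | leaf : CaretTree
  | node : CaretTree → CaretTree → CaretTree

namespace CaretTree

/-- The number of carets, that is, of interior vertices. -/
def carets : CaretTree → ℕ
  | leaf => 0
  | node A B => A.carets + B.carets + 1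

/-- All leaves of the tree, placed with its root at the address `u`, satisfy `P`. -/
def AllLeaves (P : List Bool → Prop) : CaretTree → List Bool → Prop
  | leaf, u => P u
  | node A B, u => A.AllLeaves P (u ++ [false]) ∧ B.AllLeaves P (u ++ [true])

end CaretTree

/-- The pullback of a predicate on addresses along the partial action of `g`. -/
def PullWord (g : Equiv.Perm ℝ) (P : List Bool → Prop) (u : List Bool) : Prop :=
  ∃ w, MapsWord g u w ∧ P w

lemma PullWord.mul {g h : Equiv.Perm ℝ} {P : List Bool → Prop} {u : List Bool}
    (H : PullWord h (PullWord g P) u) : PullWord (g * h) P u := by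
  obtain ⟨v, hv, w, hw, hP⟩ := H
  exact ⟨w, hw.mul hv, hP⟩

lemma CaretTree.AllLeaves.pull {g : Equiv.Perm ℝ} {P : List Bool → Prop} {T : CaretTree}
    {u w : List Bool} (hT : T.AllLeaves P w) (hg : MapsWord g u w) :
    T.AllLeaves (PullWord g P) u := by
  induction T generalizing u w with
  | leaf => exact ⟨w, hg, hT⟩
  | node A B ihA ihB => exact ⟨ihA hT.1 (hg.append _), ihB hT.2 (hg.append _)⟩

/-- `u` is the address of a maximal dyadic interval mapped affinely by `f` onto a standard
dyadic interval. -/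
def MaxGood (f : Equiv.Perm ℝ) (u : List Bool) : Prop :=
  GoodWord f u ∧ ∀ p x, p ++ x = u → x ≠ [] → ¬ GoodWord f p

lemma MaxGood.map {f : Equiv.Perm ℝ} {u w : List Bool} (hu : MaxGood f u)
    (h : MapsWord f u w) : MaxGood f⁻¹ w := by
  refine ⟨⟨u, h.inv⟩, ?_⟩
  rintro p x rfl hx ⟨q, hq⟩
  have hqp : MapsWord f q p := by simpa using hq.inv
  exact hu.2 q x ((hqp.append x).source_unique h) hx ⟨p, hqp⟩

lemma MaxGood.eq_of_overlap {f : Equiv.Perm ℝ} {u w : List Bool} (hu : MaxGood f u)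
    (hw : MaxGood f w) {s t : ℝ} (hs : s ∈ Ico (0 : ℝ) 1) (ht : t ∈ Ico (0 : ℝ) 1)
    (h : dyadicMap u s = dyadicMap w t) : u = w := by
  rcases prefix_or_prefix_of_dyadicMap_eq u w hs ht h with ⟨x, hx⟩ | ⟨x, hx⟩
  · by_cases hnil : x = []
    · simpa [hnil] using hx
    · exact absurd hu.1 (hw.2 u x hx hnil)
  · by_cases hnil : x = []
    · simpa [hnil] using hx.symm
    · exact absurd hw.1 (hu.2 w x hx hnil)

lemma exists_tree_maxGood_at {f : Equiv.Perm ℝ} (hfin : (badWords f).Finite) (N : ℕ)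
    (u : List Bool) (hN : (badWords f ∩ {w | u <+: w}).ncard ≤ N)
    (hu : ∀ p x, p ++ x = u → x ≠ [] → ¬ GoodWord f p) :
    ∃ T : CaretTree, T.carets ≤ N ∧ T.AllLeaves (MaxGood f) u := by
  induction N using Nat.strong_induction_on generalizing u with
  | _ N ih =>
    by_cases hgood : GoodWord f u
    · exact ⟨.leaf, Nat.zero_le _, hgood, hu⟩
    have hext : ∀ b p x, p ++ x = u ++ [b] → x ≠ [] → ¬ GoodWord f p := by
      intro b p x hpx hx
      rcases List.eq_nil_or_concat x with rfl | ⟨y, c, rfl⟩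
      · exact absurd rfl hx
      · rw [List.concat_eq_append, ← List.append_assoc] at hpx
        obtain ⟨h1, -⟩ := List.append_inj' hpx rfl
        by_cases hy : y = []
        · subst hy
          rw [List.append_nil] at h1
          rwa [h1]
        · exact hu p y h1 hy
    let X : Bool → Set (List Bool) := fun b => badWords f ∩ {w | u ++ [b] <+: w}
    have hXfin : ∀ b, (X b).Finite := fun b => hfin.subset inter_subset_left
    have hdisj : Disjoint (X false) (X true) := by
      rw [disjoint_left]
      rintro w ⟨-, y, rfl⟩ ⟨-, z, hz⟩
      simp at hz
    have hnot : u ∉ X false ∪ X true := by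
      rintro (⟨-, h⟩ | ⟨-, h⟩) <;> simpa using h.length_le
    have hsub : insert u (X false ∪ X true) ⊆ badWords f ∩ {w | u <+: w} := by
      rintro w (rfl | ⟨hw, h⟩ | ⟨hw, h⟩)
      · exact ⟨hgood, List.prefix_rfl⟩
      · exact ⟨hw, (List.prefix_append _ _).trans h⟩
      · exact ⟨hw, (List.prefix_append _ _).trans h⟩
    have hcard := ncard_le_ncard hsub (hfin.subset inter_subset_left)
    rw [ncard_insert_of_notMem hnot ((hXfin _).union (hXfin _)),
      ncard_union_eq hdisj (hXfin _) (hXfin _)] at hcard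
    obtain ⟨A, hA, hA'⟩ := ih (X false).ncard (by omega) (u ++ [false]) le_rfl (hext false)
    obtain ⟨B, hB, hB'⟩ := ih (X true).ncard (by omega) (u ++ [true]) le_rfl (hext true)
    exact ⟨.node A B, by simp only [CaretTree.carets]; omega, hA', hB'⟩

lemma exists_tree_maxGood {f : Equiv.Perm ℝ} {N : ℕ} (hN : (badWords f).encard ≤ N) :
    ∃ T : CaretTree, T.carets ≤ N ∧ T.AllLeaves (MaxGood f) [] := by
  have hfin := finite_of_encard_le_coe hN
  refine exists_tree_maxGood_at hfin N [] ?_ ?_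
  · have h1 : (badWords f).ncard ≤ N := by
      rw [← hfin.cast_ncard_eq] at hN
      exact_mod_cast hN
    exact (ncard_le_ncard inter_subset_left hfin).trans h1
  · intro p x hpx hx
    exact absurd (List.append_eq_nil_iff.1 hpx).2 hx

/-! ### Word length -/

/-- `g` is a product of at most `n` elements of `A`. -/
def LengthLE (A : Set (Equiv.Perm ℝ)) (g : Equiv.Perm ℝ) (n : ℕ) : Prop :=
  ∃ w : List (Equiv.Perm ℝ), w.length ≤ n ∧ (∀ x ∈ w, x ∈ A) ∧ w.prod = g

namespace LengthLE

variable {A : Set (Equiv.Perm ℝ)} {g h : Equiv.Perm ℝ} {m n : ℕ}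

lemma one (A : Set (Equiv.Perm ℝ)) : LengthLE A 1 0 := ⟨[], by simp⟩

lemma of_mem (hg : g ∈ A) : LengthLE A g 1 := ⟨[g], by simpa using hg⟩

lemma mono (hg : LengthLE A g m) (hmn : m ≤ n) : LengthLE A g n := by
  obtain ⟨w, hw, h⟩ := hg
  exact ⟨w, hw.trans hmn, h⟩

lemma mul (hg : LengthLE A g m) (hh : LengthLE A h n) : LengthLE A (g * h) (m + n) := by
  obtain ⟨w, hw, hwA, rfl⟩ := hg
  obtain ⟨z, hz, hzA, rfl⟩ := hh
  refine ⟨w ++ z, by simp only [List.length_append]; omega, ?_, List.prod_append⟩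
  intro x hx
  rcases List.mem_append.1 hx with hx | hx
  exacts [hwA x hx, hzA x hx]

lemma inv (hA : ∀ x ∈ A, x⁻¹ ∈ A) (hg : LengthLE A g m) : LengthLE A g⁻¹ m := by
  obtain ⟨w, hw, hwA, rfl⟩ := hg
  refine ⟨(w.map fun x => x⁻¹).reverse, by simpa using hw, ?_, (List.prod_inv_reverse w).symm⟩
  intro x hx
  simp only [List.mem_reverse, List.mem_map] at hx
  obtain ⟨y, hy, rfl⟩ := hx
  exact hA y (hwA y hy)

lemma prod (w : List (Equiv.Perm ℝ)) (hw : ∀ x ∈ w, LengthLE A x n) :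
    LengthLE A w.prod (w.length * n) := by
  induction w with
  | nil => simpa using one A
  | cons x w ih =>
    rw [List.prod_cons, List.length_cons, add_mul, one_mul, add_comm]
    exact (hw x (by simp)).mul (ih fun y hy => hw y (by simp [hy]))

end LengthLE

/-- The symmetric generating set of `F`. -/
abbrev genF : Set (Equiv.Perm ℝ) := {x0, x1, x0⁻¹, x1⁻¹}

lemma inv_mem_genF : ∀ x ∈ genF, x⁻¹ ∈ genF := by
  rintro x (rfl | rfl | rfl | rfl) <;> simp [genF]

lemma wordLength_le {f : Equiv.Perm ℝ} {n : ℕ} (h : LengthLE genF f n) : wordLength f ≤ n := by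
  obtain ⟨w, hw, hwA, hf⟩ := h
  have hmem : wordLength f ≤ w.length := Nat.sInf_le ⟨w, rfl, hwA, hf⟩
  exact hmem.trans hw

lemma wordLengthWith_le {S : Set (Equiv.Perm ℝ)} {f : Equiv.Perm ℝ} {n : ℕ}
    (h : LengthLE {g | g ∈ S ∨ g⁻¹ ∈ S} f n) : wordLengthWith S f ≤ n := by
  obtain ⟨w, hw, hwA, hf⟩ := h
  have hmem : wordLengthWith S f ≤ w.length := Nat.sInf_le ⟨w, rfl, hwA, hf⟩
  exact hmem.trans hw

lemma lengthLE_wordLength_of_lengthLE {f : Equiv.Perm ℝ} {n : ℕ} (h : LengthLE genF f n) :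
    LengthLE genF f (wordLength f) := by
  obtain ⟨w, -, hwA, hf⟩ := h
  obtain ⟨z, hz, hzA, hzf⟩ := Nat.sInf_mem (⟨w.length, w, rfl, hwA, hf⟩ :
    {n | ∃ w : List (Equiv.Perm ℝ), w.length = n ∧
      (∀ g ∈ w, g ∈ ({x0, x1, x0⁻¹, x1⁻¹} : Set (Equiv.Perm ℝ))) ∧ w.prod = f}.Nonempty)
  exact ⟨z, hz.le, hzA, hzf⟩

lemma lengthLE_wordLengthWith_of_lengthLE {S : Set (Equiv.Perm ℝ)} {f : Equiv.Perm ℝ} {n : ℕ}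
    (h : LengthLE {g | g ∈ S ∨ g⁻¹ ∈ S} f n) :
    LengthLE {g | g ∈ S ∨ g⁻¹ ∈ S} f (wordLengthWith S f) := by
  obtain ⟨w, -, hwA, hf⟩ := h
  obtain ⟨z, hz, hzA, hzf⟩ := Nat.sInf_mem (⟨w.length, w, rfl, hwA, hf⟩ :
    {n | ∃ w : List (Equiv.Perm ℝ), w.length = n ∧
      (∀ g ∈ w, g ∈ S ∨ g⁻¹ ∈ S) ∧ w.prod = f}.Nonempty)
  exact ⟨z, hz.le, hzA, hzf⟩

lemma exists_lengthLE_of_mem_ThompsonF {f : Equiv.Perm ℝ} (hf : f ∈ ThompsonF) :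
    ∃ n, LengthLE genF f n := by
  induction hf using Subgroup.closure_induction with
  | mem x hx =>
    refine ⟨1, .of_mem ?_⟩
    rcases hx with rfl | rfl <;> simp [genF]
  | one => exact ⟨0, .one _⟩
  | mul x y _ _ hx hy =>
    obtain ⟨m, hm⟩ := hx
    obtain ⟨n, hn⟩ := hy
    exact ⟨_, hm.mul hn⟩
  | inv x _ hx =>
    obtain ⟨m, hm⟩ := hx
    exact ⟨m, hm.inv inv_mem_genF⟩

/-! ### The generators of `F` -/

lemma x0_strictMono : StrictMono x0 := by
  intro s t hst
  change x0fun s < x0fun t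
  unfold x0fun
  split_ifs <;> linarith

lemma x1_strictMono : StrictMono x1 := by
  intro s t hst
  change x1fun s < x1fun t
  unfold x1fun
  split_ifs <;> linarith

lemma strictMono_inv {g : Equiv.Perm ℝ} (hg : StrictMono g) :
    StrictMono (g⁻¹ : Equiv.Perm ℝ) := by
  intro s t hst
  rw [← hg.lt_iff_lt]
  exact ((g.apply_symm_apply s).trans_lt hst).trans_eq (g.apply_symm_apply t).symm

lemma x0_apply_of_notMem {t : ℝ} (ht : t ∉ Ico (0 : ℝ) 1) : x0 t = t := by
  rw [mem_Ico, not_and, not_lt] at ht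
  change x0fun t = t
  unfold x0fun
  split_ifs <;> first | rfl | linarith [ht (by linarith)]

lemma x1_apply_of_notMem {t : ℝ} (ht : t ∉ Ico (0 : ℝ) 1) : x1 t = t := by
  rw [mem_Ico, not_and, not_lt] at ht
  change x1fun t = t
  unfold x1fun
  split_ifs <;> first | rfl | linarith [ht (by linarith)]

/-- The increasing permutations of `ℝ` supported in `[0,1)`. -/
def orderedPerms : Subgroup (Equiv.Perm ℝ) where
  carrier := {g | StrictMono g ∧ ∀ t, t ∉ Ico (0 : ℝ) 1 → g t = t}
  one_mem' := ⟨fun _ _ h => h, fun _ _ => rfl⟩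
  mul_mem' := fun {g h} hg hh => ⟨hg.1.comp hh.1, fun t ht => by
    rw [Equiv.Perm.mul_apply, hh.2 t ht, hg.2 t ht]⟩
  inv_mem' := fun {g} hg => ⟨strictMono_inv hg.1, fun t ht => by
    rw [Equiv.Perm.inv_eq_iff_eq, hg.2 t ht]⟩

lemma ThompsonF_le_orderedPerms : ThompsonF ≤ orderedPerms := by
  rw [ThompsonF, Subgroup.closure_le]
  rintro g (rfl | rfl)
  · exact ⟨x0_strictMono, fun _ => x0_apply_of_notMem⟩
  · exact ⟨x1_strictMono, fun _ => x1_apply_of_notMem⟩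

lemma mem_ThompsonF_of_lengthLE {f : Equiv.Perm ℝ} {n : ℕ} (h : LengthLE genF f n) :
    f ∈ ThompsonF := by
  obtain ⟨w, -, hw, rfl⟩ := h
  refine Subgroup.list_prod_mem _ fun x hx => ?_
  have h0 : x0 ∈ ThompsonF := Subgroup.subset_closure (by simp)
  have h1 : x1 ∈ ThompsonF := Subgroup.subset_closure (by simp)
  rcases hw x hx with rfl | rfl | rfl | rfl
  exacts [h0, h1, inv_mem h0, inv_mem h1]

lemma apply_mem_unit {g : Equiv.Perm ℝ} (hg : g ∈ orderedPerms) {t : ℝ}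
    (ht : t ∈ Ico (0 : ℝ) 1) : g t ∈ Ico (0 : ℝ) 1 := by
  by_contra h
  have := hg.2 _ h
  rw [g.injective this] at h
  exact h ht

lemma mapsWord_x0_0 : MapsWord x0 [false] [false, false] := by
  rintro s ⟨h0, h1⟩
  simp only [dyadicMap, Bool.false_eq_true, if_false]
  change x0fun _ = _
  unfold x0fun
  split_ifs <;> linarith

lemma mapsWord_x0_10 : MapsWord x0 [true, false] [false, true] := by
  rintro s ⟨h0, h1⟩
  simp only [dyadicMap, Bool.false_eq_true, if_true, if_false]
  change x0fun _ = _
  unfold x0fun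
  split_ifs <;> linarith

lemma mapsWord_x0_11 : MapsWord x0 [true, true] [true] := by
  rintro s ⟨h0, h1⟩
  simp only [dyadicMap, if_true]
  change x0fun _ = _
  unfold x0fun
  split_ifs <;> linarith

lemma mapsWord_x1_0 : MapsWord x1 [false] [false] := by
  rintro s ⟨h0, h1⟩
  simp only [dyadicMap, Bool.false_eq_true, if_false]
  change x1fun _ = _
  unfold x1fun
  split_ifs <;> linarith

lemma mapsWord_x1_10 : MapsWord x1 [true, false] [true, false, false] := by
  rintro s ⟨h0, h1⟩
  simp only [dyadicMap, Bool.false_eq_true, if_true, if_false]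
  change x1fun _ = _
  unfold x1fun
  split_ifs <;> linarith

lemma mapsWord_x1_110 : MapsWord x1 [true, true, false] [true, false, true] := by
  rintro s ⟨h0, h1⟩
  simp only [dyadicMap, Bool.false_eq_true, if_true, if_false]
  change x1fun _ = _
  unfold x1fun
  split_ifs <;> linarith

lemma mapsWord_x1_111 : MapsWord x1 [true, true, true] [true, true] := by
  rintro s ⟨h0, h1⟩
  simp only [dyadicMap, if_true]
  change x1fun _ = _
  unfold x1fun
  split_ifs <;> linarith

lemma affine_piece {v : Equiv.Perm ℝ} (a a' b b' c d : ℝ) (ha : IsStdDyadicPair a a')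
    (hb : IsStdDyadicPair b b') (hc : 0 < c) (hv : ∀ t ∈ Ico a a', v t = c * t + d)
    (h0 : c * a + d = b) (h1 : c * a' + d = b') :
    IsStdDyadicPair a a' ∧ IsStdDyadicPair b b' ∧ ∃ c d : ℝ, 0 < c ∧
      (∀ t ∈ Ico a a', v t = c * t + d) ∧ c * a + d = b ∧ c * a' + d = b' :=
  ⟨ha, hb, c, d, hc, hv, h0, h1⟩

lemma memV_x0 : MemV x0 := by
  refine ⟨fun _ => x0_apply_of_notMem, 3, ![0, 1/2, 3/4, 1], ![0, 1/4, 1/2, 1], 1,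
    rfl, rfl, rfl, rfl, ?_, ?_, ?_⟩
  · norm_num
    exact Subsingleton.strictMono (α := Fin 1) _
  · norm_num
    exact Subsingleton.strictMono (α := Fin 1) _
  · intro i
    fin_cases i
    · refine affine_piece 0 (1/2) 0 (1/4) (1/2) (0) ⟨0, 1, by norm_num, by norm_num⟩
        ⟨0, 2, by norm_num, by norm_num⟩ (by norm_num) ?_ (by norm_num) (by norm_num)
      rintro t ⟨h0, h1⟩
      change x0fun t = _
      unfold x0fun
      split_ifs <;> linarith
    · refine affine_piece (1/2) (3/4) (1/4) (1/2) (1) (-1/4) ⟨2, 2, by norm_num, by norm_num⟩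
        ⟨1, 2, by norm_num, by norm_num⟩ (by norm_num) ?_ (by norm_num) (by norm_num)
      rintro t ⟨h0, h1⟩
      change x0fun t = _
      unfold x0fun
      split_ifs <;> linarith
    · refine affine_piece (3/4) 1 (1/2) 1 (2) (-1) ⟨3, 2, by norm_num, by norm_num⟩
        ⟨1, 1, by norm_num, by norm_num⟩ (by norm_num) ?_ (by norm_num) (by norm_num)
      rintro t ⟨h0, h1⟩
      change x0fun t = _
      unfold x0fun
      split_ifs <;> linarith

lemma memV_x1 : MemV x1 := by
  refine ⟨fun _ => x1_apply_of_notMem, 4, ![0, 1/2, 3/4, 7/8, 1], ![0, 1/2, 5/8, 3/4, 1], 1,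
    rfl, rfl, rfl, rfl, ?_, ?_, ?_⟩
  · norm_num
    exact Subsingleton.strictMono (α := Fin 1) _
  · norm_num
    exact Subsingleton.strictMono (α := Fin 1) _
  · intro i
    fin_cases i
    · refine affine_piece 0 (1/2) 0 (1/2) (1) (0) ⟨0, 1, by norm_num, by norm_num⟩
        ⟨0, 1, by norm_num, by norm_num⟩ (by norm_num) ?_ (by norm_num) (by norm_num)
      rintro t ⟨h0, h1⟩
      change x1fun t = _
      unfold x1fun
      split_ifs <;> linarith
    · refine affine_piece (1/2) (3/4) (1/2) (5/8) (1/2) (1/4) ⟨2, 2, by norm_num, by norm_num⟩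
        ⟨4, 3, by norm_num, by norm_num⟩ (by norm_num) ?_ (by norm_num) (by norm_num)
      rintro t ⟨h0, h1⟩
      change x1fun t = _
      unfold x1fun
      split_ifs <;> linarith
    · refine affine_piece (3/4) (7/8) (5/8) (3/4) (1) (-1/8) ⟨6, 3, by norm_num, by norm_num⟩
        ⟨5, 3, by norm_num, by norm_num⟩ (by norm_num) ?_ (by norm_num) (by norm_num)
      rintro t ⟨h0, h1⟩
      change x1fun t = _
      unfold x1fun
      split_ifs <;> linarith
    · refine affine_piece (7/8) 1 (3/4) 1 (2) (-1) ⟨7, 3, by norm_num, by norm_num⟩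
        ⟨3, 2, by norm_num, by norm_num⟩ (by norm_num) ?_ (by norm_num) (by norm_num)
      rintro t ⟨h0, h1⟩
      change x1fun t = _
      unfold x1fun
      split_ifs <;> linarith

/-! ### Building trees from carets -/

/-- The address `1ⁿ`. -/
def ones (n : ℕ) : List Bool := List.replicate n true

/-- The address `1ⁿ0`. -/
def vineLeaf (n : ℕ) : List Bool := ones n ++ [false]

lemma ones_add (m n : ℕ) : ones (m + n) = ones m ++ ones n :=
  List.replicate_add m n true

lemma MapsWord.ones_shift {g : Equiv.Perm ℝ} {m n : ℕ} (h : MapsWord g (ones m) (ones n))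
    (k : ℕ) : MapsWord g (ones (m + k)) (ones (n + k)) := by
  rw [ones_add, ones_add]
  exact h.append _

lemma MapsWord.vineLeaf_shift {g : Equiv.Perm ℝ} {m n : ℕ} (h : MapsWord g (ones m) (ones n))
    (k : ℕ) : MapsWord g (vineLeaf (m + k)) (vineLeaf (n + k)) :=
  (h.ones_shift k).append [false]

lemma x0_ones : MapsWord x0 (ones 2) (ones 1) := mapsWord_x0_11

lemma x1_ones : MapsWord x1 (ones 3) (ones 2) := mapsWord_x1_111

lemma lengthLE_x0 : LengthLE genF x0 1 := .of_mem (by simp [genF])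

lemma lengthLE_x1 : LengthLE genF x1 1 := .of_mem (by simp [genF])

lemma lengthLE_x0_inv : LengthLE genF x0⁻¹ 1 := .of_mem (by simp [genF])

/-- Every tree rooted at the address `10` is the image of consecutive leaves of the right vine
under a short element of `F` supported in `[1/2,1)`. -/
lemma exists_build_inner (T : CaretTree) : ∃ h : Equiv.Perm ℝ,
    LengthLE genF h (3 * T.carets) ∧ MapsWord h [false] [false] ∧
    MapsWord h (ones (T.carets + 2)) (ones 2) ∧
    ∀ P, T.AllLeaves P [true, false] → ∀ j ≤ T.carets, PullWord h P (vineLeaf (j + 1)) := by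
  induction T with
  | leaf =>
    refine ⟨1, .one _, .one _, .one _, fun P hP j hj => ⟨[true, false], ?_, hP⟩⟩
    obtain rfl : j = 0 := by simpa [CaretTree.carets] using hj
    exact .one _
  | node A B ihA ihB =>
    obtain ⟨a, hal, ha0, ha1, ha⟩ := ihA
    obtain ⟨b, hbl, hb0, hb1, hb⟩ := ihB
    refine ⟨x1 * x0⁻¹ * b * x0 * a, ?_, ?_, ?_, ?_⟩
    · exact ((((lengthLE_x1.mul lengthLE_x0_inv).mul hbl).mul lengthLE_x0).mul hal).mono
        (by simp only [CaretTree.carets]; omega)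
    · exact (((mapsWord_x1_0.mul mapsWord_x0_0.inv).mul (hb0.append [false])).mul
        mapsWord_x0_0).mul ha0
    · have h1 := ha1.ones_shift (B.carets + 1)
      have h2 := x0_ones.ones_shift (B.carets + 1)
      have h3 := x0_ones.inv.ones_shift 1
      rw [show 1 + (B.carets + 1) = B.carets + 2 by omega] at h2
      rw [show A.carets + 2 + (B.carets + 1) = (CaretTree.node A B).carets + 2 by
        simp only [CaretTree.carets]; omega] at h1
      exact (((x1_ones.mul h3).mul hb1).mul h2).mul h1
    · rintro P ⟨hA, hB⟩ j hj
      have hA1 := hA.pull mapsWord_x1_10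
      have hB1 := (hB.pull mapsWord_x1_110).pull (mapsWord_x0_11.inv.append [false])
      have hA2 := ((hA1.pull mapsWord_x0_10.inv).pull (hb0.append [true])).pull mapsWord_x0_10
      rcases le_or_gt j A.carets with hjA | hjA
      · exact (ha _ hA2 j hjA).mul.mul.mul.mul
      · obtain ⟨k, rfl⟩ : ∃ k, j = A.carets + 1 + k := ⟨j - (A.carets + 1), by omega⟩
        have hk : k ≤ B.carets := by simp only [CaretTree.carets] at hj; omega
        have h1 := ha1.vineLeaf_shift k
        have h2 := x0_ones.vineLeaf_shift k
        rw [show A.carets + 2 + k = A.carets + 1 + k + 1 by omega] at h1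
        rw [show 1 + k = k + 1 by omega] at h2
        have h3 : PullWord a (PullWord x0 _) _ := ⟨_, h1, _, h2, hb _ hB1 k hk⟩
        exact h3.mul.mul.mul.mul

/-- Every tree rooted at the address `0` is the image of the first leaves of the right vine
under a short element of `F`. -/
lemma exists_build_left (T : CaretTree) : ∃ h : Equiv.Perm ℝ,
    LengthLE genF h (3 * T.carets) ∧ MapsWord h (ones (T.carets + 1)) (ones 1) ∧
    ∀ P, T.AllLeaves P [false] → ∀ j ≤ T.carets, PullWord h P (vineLeaf j) := by
  induction T with
  | leaf =>
    refine ⟨1, .one _, .one _, fun P hP j hj => ⟨[false], ?_, hP⟩⟩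
    obtain rfl : j = 0 := by simpa [CaretTree.carets] using hj
    exact .one _
  | node A B ihA _ =>
    obtain ⟨a, hal, ha1, ha⟩ := ihA
    obtain ⟨b, hbl, hb0, hb1, hb⟩ := exists_build_inner B
    refine ⟨x0 * b * a, ?_, ?_, ?_⟩
    · exact ((lengthLE_x0.mul hbl).mul hal).mono (by simp only [CaretTree.carets]; omega)
    · have h1 := ha1.ones_shift (B.carets + 1)
      rw [show 1 + (B.carets + 1) = B.carets + 2 by omega,
        show A.carets + 1 + (B.carets + 1) = (CaretTree.node A B).carets + 1 by
          simp only [CaretTree.carets]; omega] at h1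
      exact (x0_ones.mul hb1).mul h1
    · rintro P ⟨hA, hB⟩ j hj
      have hA1 := (hA.pull mapsWord_x0_0).pull hb0
      have hB1 := hB.pull mapsWord_x0_10
      rcases le_or_gt j A.carets with hjA | hjA
      · exact (ha _ hA1 j hjA).mul.mul
      · obtain ⟨k, rfl⟩ : ∃ k, j = A.carets + 1 + k := ⟨j - (A.carets + 1), by omega⟩
        have hk : k ≤ B.carets := by simp only [CaretTree.carets] at hj; omega
        have h1 := ha1.vineLeaf_shift k
        rw [show 1 + k = k + 1 by omega] at h1
        have h2 : PullWord a _ _ := ⟨_, h1, hb _ hB1 k hk⟩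
        exact h2.mul.mul

/-- Every tree rooted at the address `1` is the image of the right vine rooted there under a
short element of `F` supported in `[1/2,1)`. -/
lemma exists_build_right (T : CaretTree) : ∃ h : Equiv.Perm ℝ,
    LengthLE genF h (3 * T.carets) ∧ MapsWord h [false] [false] ∧
    ∀ P, T.AllLeaves P [true] → (∀ j < T.carets, PullWord h P (vineLeaf (j + 1))) ∧
      PullWord h P (ones (T.carets + 1)) := by
  induction T with
  | leaf =>
    exact ⟨1, .one _, .one _, fun P hP => ⟨fun j hj => absurd hj (Nat.not_lt_zero j),
      [true], .one _, hP⟩⟩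
  | node A B _ ihB =>
    obtain ⟨a, hal, ha0, ha1, ha⟩ := exists_build_inner A
    obtain ⟨b, hbl, hb0, hb⟩ := ihB
    refine ⟨x0⁻¹ * b * x0 * a, ?_, ?_, ?_⟩
    · exact (((lengthLE_x0_inv.mul hbl).mul lengthLE_x0).mul hal).mono
        (by simp only [CaretTree.carets]; omega)
    · exact ((mapsWord_x0_0.inv.mul (hb0.append [false])).mul mapsWord_x0_0).mul ha0
    · rintro P ⟨hA, hB⟩
      have hA1 := ((hA.pull mapsWord_x0_10.inv).pull (hb0.append [true])).pull mapsWord_x0_10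
      have hB1 := hb _ (hB.pull mapsWord_x0_11.inv)
      constructor
      · intro j hj
        rcases le_or_gt j A.carets with hjA | hjA
        · exact (ha _ hA1 j hjA).mul.mul.mul
        · obtain ⟨k, rfl⟩ : ∃ k, j = A.carets + 1 + k := ⟨j - (A.carets + 1), by omega⟩
          have hk : k < B.carets := by simp only [CaretTree.carets] at hj; omega
          have h1 := ha1.vineLeaf_shift k
          have h2 := x0_ones.vineLeaf_shift k
          rw [show A.carets + 2 + k = A.carets + 1 + k + 1 by omega] at h1
          rw [show 1 + k = k + 1 by omega] at h2
          have h3 : PullWord a (PullWord x0 _) _ := ⟨_, h1, _, h2, hB1.1 k hk⟩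
          exact h3.mul.mul.mul
      · have h1 := ha1.ones_shift B.carets
        have h2 := x0_ones.ones_shift B.carets
        rw [show A.carets + 2 + B.carets = (CaretTree.node A B).carets + 1 by
          simp only [CaretTree.carets]; omega] at h1
        rw [show 1 + B.carets = B.carets + 1 by omega] at h2
        have h3 : PullWord a (PullWord x0 _) _ := ⟨_, h1, _, h2, hB1.2⟩
        exact h3.mul.mul.mul

/-- Every tree is the image of the right vine with as many carets under a short element
of `F`. -/
lemma exists_build (T : CaretTree) : ∃ h : Equiv.Perm ℝ,
    LengthLE genF h (3 * T.carets) ∧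
    ∀ P, T.AllLeaves P [] → (∀ j < T.carets, PullWord h P (vineLeaf j)) ∧
      PullWord h P (ones T.carets) := by
  cases T with
  | leaf =>
    exact ⟨1, .one _, fun P hP => ⟨fun j hj => absurd hj (Nat.not_lt_zero j), [], .one _, hP⟩⟩
  | node A B =>
    obtain ⟨a, hal, ha1, ha⟩ := exists_build_left A
    obtain ⟨b, hbl, hb0, hb⟩ := exists_build_right B
    refine ⟨b * a, (hbl.mul hal).mono (by simp only [CaretTree.carets]; omega), ?_⟩
    rintro P ⟨hA, hB⟩
    have hB1 := hb _ hB
    constructor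
    · intro j hj
      rcases le_or_gt j A.carets with hjA | hjA
      · exact (ha _ (hA.pull hb0) j hjA).mul
      · obtain ⟨k, rfl⟩ : ∃ k, j = A.carets + 1 + k := ⟨j - (A.carets + 1), by omega⟩
        have hk : k < B.carets := by simp only [CaretTree.carets] at hj; omega
        have h1 := ha1.vineLeaf_shift k
        rw [show 1 + k = k + 1 by omega] at h1
        have h2 : PullWord a _ _ := ⟨_, h1, hB1.1 k hk⟩
        exact h2.mul
    · have h1 := ha1.ones_shift B.carets
      rw [show A.carets + 1 + B.carets = (CaretTree.node A B).carets by
        simp only [CaretTree.carets]; omega, show 1 + B.carets = B.carets + 1 by omega] at h1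
      have h2 : PullWord a _ _ := ⟨_, h1, hB1.2⟩
      exact h2.mul

/-! ### Rigidity of increasing maps between right vines -/

lemma dyadicMap_ones (n : ℕ) (s : ℝ) : dyadicMap (ones n) s = 1 - (1 - s) / 2 ^ n := by
  induction n with
  | zero => simp [ones, dyadicMap]
  | succ n ih =>
    rw [ones, List.replicate_succ, dyadicMap, ← ones, ih, pow_succ]
    simp only [if_true]
    field_simp
    ring

lemma dyadicMap_vineLeaf (n : ℕ) (s : ℝ) :
    dyadicMap (vineLeaf n) s = 1 - (1 - s / 2) / 2 ^ n := by
  rw [vineLeaf, dyadicMap_append, dyadicMap_ones]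
  simp [dyadicMap]

/-- The leaves of right vines. -/
def IsVineWord (w : List Bool) : Prop := ∃ n, w = ones n ∨ w = vineLeaf n

lemma vine_cover (n : ℕ) {t : ℝ} (ht : t ∈ Ico (0 : ℝ) 1) :
    (∃ j < n, ∃ s ∈ Ico (0 : ℝ) 1, t = dyadicMap (vineLeaf j) s) ∨
      ∃ s ∈ Ico (0 : ℝ) 1, t = dyadicMap (ones n) s := by
  induction n with
  | zero => exact Or.inr ⟨t, ht, rfl⟩
  | succ n ih =>
    rcases ih with ⟨j, hj, h⟩ | ⟨s, ⟨h0, h1⟩, rfl⟩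
    · exact Or.inl ⟨j, by omega, h⟩
    rcases lt_or_ge s (1 / 2) with h | h
    · refine Or.inl ⟨n, by omega, 2 * s, ⟨by linarith, by linarith⟩, ?_⟩
      rw [dyadicMap_ones, dyadicMap_vineLeaf]
      ring
    · refine Or.inr ⟨2 * s - 1, ⟨by linarith, by linarith⟩, ?_⟩
      rw [dyadicMap_ones, dyadicMap_ones, pow_succ]
      ring

lemma apply_eq_self_of_fix_below {g : Equiv.Perm ℝ} (hg : StrictMono g) {a : ℝ}
    (h : ∀ t < a, g t = t) : g a = a := by
  rcases lt_trichotomy (g a) a with hlt | heq | hgt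
  · exact g.injective (h _ hlt)
  · exact heq
  · obtain ⟨r, hr⟩ := g.surjective a
    have hra : r < a := hg.lt_iff_lt.1 (by rwa [hr])
    rw [h r hra] at hr
    exact absurd hr hra.ne

/-- Within an increasing permutation fixing everything below `1 - 2⁻ʲ`, a vine word with left
endpoint `1 - 2⁻ʲ` is only mapped to such a word. -/
lemma vineWord_target {g : Equiv.Perm ℝ} (hg : StrictMono g) {j : ℕ} {u w : List Bool}
    (hfix : ∀ t < 1 - 1 / (2 : ℝ) ^ j, g t = t) (hu : dyadicMap u 0 = 1 - 1 / 2 ^ j)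
    (hm : MapsWord g u w) (hw : IsVineWord w) : w = ones j ∨ w = vineLeaf j := by
  have h := hm 0 zero_mem_unit
  rw [hu, apply_eq_self_of_fix_below hg hfix] at h
  obtain ⟨i, rfl | rfl⟩ := hw
  · rw [dyadicMap_ones] at h
    have h2 : (2 : ℝ) ^ j = 2 ^ i := by
      have : (1 : ℝ) / 2 ^ j = 1 / 2 ^ i := by linarith
      field_simp at this
      exact this.symm
    rw [pow_right_injective₀ (by norm_num) (by norm_num) h2]
    exact Or.inl rfl
  · rw [dyadicMap_vineLeaf] at h
    have h2 : (2 : ℝ) ^ j = 2 ^ i := by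
      have : (1 : ℝ) / 2 ^ j = 1 / 2 ^ i := by linarith
      field_simp at this
      exact this.symm
    rw [pow_right_injective₀ (by norm_num) (by norm_num) h2]
    exact Or.inr rfl

lemma eq_one_of_vine {g : Equiv.Perm ℝ} (hg : g ∈ orderedPerms) {n : ℕ}
    (hleaf : ∀ j < n, ∃ w, MapsWord g (vineLeaf j) w ∧ IsVineWord w)
    (hlast : ∃ w, MapsWord g (ones n) w ∧ IsVineWord w) : g = 1 := by
  have hfix : ∀ j ≤ n, ∀ t < 1 - 1 / (2 : ℝ) ^ j, g t = t := by
    intro j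
    induction j with
    | zero => exact fun _ t ht => hg.2 t fun h => by norm_num at ht; linarith [h.1]
    | succ j ih =>
      intro hj t ht
      have ih := ih (by omega)
      rcases lt_or_ge t (1 - 1 / 2 ^ j) with h | h
      · exact ih t h
      obtain ⟨w, hw, hv⟩ := hleaf j (by omega)
      have hpos : (0 : ℝ) < 1 / 2 ^ j := by positivity
      have hmid : 1 - 1 / (2 : ℝ) ^ (j + 1) = 1 - 1 / 2 ^ j / 2 := by
        rw [pow_succ]
        ring
      rcases vineWord_target hg.1 ih (by rw [dyadicMap_vineLeaf]; norm_num) hw hv with rfl | rfl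
      · exfalso
        have hmem : (1 - 1 / 2 ^ j / 2 : ℝ) ∈ Ico (0 : ℝ) 1 := by
          have : (1 : ℝ) / 2 ^ j ≤ 1 := by
            rw [div_le_one (by positivity)]
            exact one_le_pow₀ (by norm_num)
          constructor <;> linarith
        have hlt := (apply_mem_unit hg hmem).2
        have hge := hg.1 (show 1 - 1 / (2 : ℝ) ^ j < 1 - 1 / 2 ^ j / 2 by linarith)
        rw [apply_eq_self_of_fix_below hg.1 ih] at hge
        let s : ℝ := 1 - (1 - g (1 - 1 / 2 ^ j / 2)) * 2 ^ j
        have hs : s ∈ Ico (0 : ℝ) 1 := by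
          have hp : (0 : ℝ) < 2 ^ j := by positivity
          constructor
          · have : (1 - g (1 - 1 / 2 ^ j / 2)) * 2 ^ j ≤ 1 / 2 ^ j * 2 ^ j := by
              gcongr
              linarith
            rw [div_mul_cancel₀ _ hp.ne'] at this
            simp only [s]
            linarith
          · have : 0 < (1 - g (1 - 1 / 2 ^ j / 2)) * 2 ^ j := mul_pos (by linarith) hp
            simp only [s]
            linarith
        have heq := hw s hs
        have hs' : dyadicMap (ones j) s = g (1 - 1 / 2 ^ j / 2) := by
          rw [dyadicMap_ones]
          simp only [s]
          field_simp
          ring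
        rw [hs'] at heq
        have heq := g.injective heq
        rw [dyadicMap_vineLeaf] at heq
        have hlt2 : (1 : ℝ) / 2 ^ j / 2 < (1 - s / 2) / 2 ^ j := by
          rw [div_right_comm]
          gcongr
          linarith [hs.2]
        linarith
      · have hs : (t - (1 - 1 / 2 ^ j)) * (2 * 2 ^ j) ∈ Ico (0 : ℝ) 1 := by
          constructor
          · exact mul_nonneg (by linarith) (by positivity)
          · have : (t - (1 - 1 / 2 ^ j)) * (2 * 2 ^ j) < 1 / 2 ^ j / 2 * (2 * 2 ^ j) := by
              gcongr
              linarith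
            refine this.trans_eq ?_
            field_simp
        have heq := hw _ hs
        have ht' : dyadicMap (vineLeaf j) ((t - (1 - 1 / 2 ^ j)) * (2 * 2 ^ j)) = t := by
          rw [dyadicMap_vineLeaf]
          field_simp
          ring
        rwa [ht'] at heq
  have hfixn := hfix n le_rfl
  obtain ⟨w, hw, hv⟩ := hlast
  have hpos : (0 : ℝ) < 1 / 2 ^ n := by positivity
  have hsurj : ∀ t ∈ Ico (1 - 1 / (2 : ℝ) ^ n) 1,
      ∃ s ∈ Ico (0 : ℝ) 1, t = dyadicMap (ones n) s := by
    rintro t ⟨h0, h1⟩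
    refine ⟨1 - (1 - t) * 2 ^ n, ⟨?_, ?_⟩, ?_⟩
    · have : (1 - t) * 2 ^ n ≤ 1 / 2 ^ n * 2 ^ n := by
        gcongr
        linarith
      rw [div_mul_cancel₀ _ (by positivity)] at this
      linarith
    · have : 0 < (1 - t) * 2 ^ n := mul_pos (by linarith) (by positivity)
      linarith
    · rw [dyadicMap_ones]
      field_simp
      ring
  have hid : ∀ t, t < 1 - 1 / (2 : ℝ) ^ n ∨ t ∈ Ico (1 - 1 / (2 : ℝ) ^ n) 1 ∨ 1 ≤ t := by
    intro t
    by_cases h1 : t < 1 - 1 / 2 ^ n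
    · exact Or.inl h1
    · rcases lt_or_ge t 1 with h2 | h2
      · exact Or.inr (Or.inl ⟨not_lt.1 h1, h2⟩)
      · exact Or.inr (Or.inr h2)
  rcases vineWord_target hg.1 hfixn (by rw [dyadicMap_ones]; norm_num) hw hv with rfl | rfl
  · ext t
    rcases hid t with h | h | h
    · exact hfixn t h
    · obtain ⟨s, hs, rfl⟩ := hsurj t h
      exact hw s hs
    · exact hg.2 t fun h' => absurd h'.2 (not_lt.2 h)
  · exfalso
    obtain ⟨r, hr⟩ := g.surjective (1 - 1 / 2 ^ n / 2)
    rcases hid r with h | h | h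
    · rw [hfixn r h] at hr
      linarith
    · obtain ⟨s, hs, rfl⟩ := hsurj r h
      rw [hw s hs, dyadicMap_vineLeaf] at hr
      have : (1 : ℝ) / 2 ^ n / 2 < (1 - s / 2) / 2 ^ n := by
        rw [div_right_comm]
        gcongr
        linarith [hs.2]
      linarith
    · rw [hg.2 r fun h' => absurd h'.2 (not_lt.2 h)] at hr
      linarith

/-! ### Comparison of the word lengths -/

/-- The word length in `F` is bounded linearly in the numbers of carets of the two trees. -/
lemma lengthLE_of_encard_badWords {f : Equiv.Perm ℝ} (hf : f ∈ ThompsonF) {m n : ℕ}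
    (hm : (badWords f).encard ≤ m) (hn : (badWords f⁻¹).encard ≤ n) :
    LengthLE genF f (3 * n + 3 * m) := by
  obtain ⟨T, hTm, hT⟩ := exists_tree_maxGood hm
  obtain ⟨T', hTn, hT'⟩ := exists_tree_maxGood hn
  obtain ⟨h, hl, hh⟩ := exists_build T
  obtain ⟨h', hl', hh'⟩ := exists_build T'
  obtain ⟨hleaf, hlast⟩ := hh _ hT
  obtain ⟨hleaf', hlast'⟩ := hh' _ hT'
  have hF := mem_ThompsonF_of_lengthLE hl
  have hF' := mem_ThompsonF_of_lengthLE hl'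
  have htarget : ∀ u, PullWord h (MaxGood f) u →
      ∃ v, MapsWord (h'⁻¹ * f * h) u v ∧ IsVineWord v := by
    rintro u ⟨w, hw, hmax⟩
    obtain ⟨z, hz⟩ := hmax.1
    have hzmax := hmax.map hz
    have key : ∀ v s, s ∈ Ico (0 : ℝ) 1 → h'⁻¹ (dyadicMap z 0) = dyadicMap v s →
        PullWord h' (MaxGood f⁻¹) v → MapsWord (h'⁻¹ * f * h) u v := by
      rintro v s hs heq ⟨z', hz', hmax'⟩
      rw [Equiv.Perm.inv_eq_iff_eq, hz' s hs] at heq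
      obtain rfl := hzmax.eq_of_overlap hmax' zero_mem_unit hs heq
      exact (hz'.inv.mul hz).mul hw
    have hmem := apply_mem_unit (ThompsonF_le_orderedPerms (inv_mem hF'))
      (dyadicMap_mem z zero_mem_unit)
    rcases vine_cover T'.carets hmem with ⟨j, hj, s, hs, heq⟩ | ⟨s, hs, heq⟩
    · exact ⟨_, key _ s hs heq (hleaf' j hj), j, Or.inr rfl⟩
    · exact ⟨_, key _ s hs heq hlast', T'.carets, Or.inl rfl⟩
  have hone : h'⁻¹ * f * h = 1 :=
    eq_one_of_vine (ThompsonF_le_orderedPerms (mul_mem (mul_mem (inv_mem hF') hf) hF))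
      (fun j hj => htarget _ (hleaf j hj)) (htarget _ hlast)
  have hfeq : f = h' * h⁻¹ := by
    rw [mul_assoc, inv_mul_eq_one] at hone
    rw [hone, mul_assoc, mul_inv_cancel, mul_one]
  rw [hfeq]
  exact (hl'.mul (hl.inv inv_mem_genF)).mono (by omega)

lemma exists_badWords_bound {S : Set (Equiv.Perm ℝ)} (hfin : S.Finite) (hS : ∀ s ∈ S, MemV s) :
    ∃ K : ℕ, ∀ g, g ∈ S ∨ g⁻¹ ∈ S → (badWords g).encard ≤ K := by
  obtain ⟨K, hK⟩ := (hfin.image fun s => (badWords s).ncard + (badWords s⁻¹).ncard).bddAbove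
  refine ⟨K, fun g hg => ?_⟩
  rcases hg with hg | hg
  · rw [← (hS g hg).finite_badWords.1.cast_ncard_eq]
    have := hK (mem_image_of_mem _ hg)
    exact Nat.cast_le.2 ((Nat.le_add_right _ _).trans this)
  · have h := (hS _ hg).finite_badWords.2
    have := hK (mem_image_of_mem _ hg)
    simp only [inv_inv] at h this
    rw [← h.cast_ncard_eq]
    exact Nat.cast_le.2 (by omega)

theorem F_in_V_quasi_isometric (S : Set (Equiv.Perm ℝ)) (hS : GeneratesV S) :
    ∃ C : ℝ, 1 ≤ C ∧ ∀ f : Equiv.Perm ℝ, f ∈ ThompsonF →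
      (1 / C) * (wordLength f : ℝ) ≤ (wordLengthWith S f : ℝ) ∧
      (wordLengthWith S f : ℝ) ≤ C * (wordLength f : ℝ) := by
  obtain ⟨hfin, hV, hgen⟩ := hS
  obtain ⟨K, hK⟩ := exists_badWords_bound hfin hV
  let A : Set (Equiv.Perm ℝ) := {g | g ∈ S ∨ g⁻¹ ∈ S}
  have hA : ∀ x ∈ A, x⁻¹ ∈ A := fun x hx => hx.symm.imp id fun h => by rwa [inv_inv]
  obtain ⟨w₀, hw₀, hw₀x⟩ := hgen x0 memV_x0
  obtain ⟨w₁, hw₁, hw₁x⟩ := hgen x1 memV_x1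
  let M : ℕ := w₀.length + w₁.length
  have h0 : LengthLE A x0 M := ⟨w₀, Nat.le_add_right _ _, hw₀, hw₀x⟩
  have h1 : LengthLE A x1 M := ⟨w₁, Nat.le_add_left _ _, hw₁, hw₁x⟩
  have hM : ∀ x ∈ genF, LengthLE A x M := by
    rintro x (rfl | rfl | rfl | rfl)
    exacts [h0, h1, h0.inv hA, h1.inv hA]
  have hCpos : (0 : ℝ) < 1 + M + 6 * K := by positivity
  refine ⟨1 + M + 6 * K, by linarith [M.cast_nonneg (α := ℝ), K.cast_nonneg (α := ℝ)], ?_⟩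
  intro f hf
  obtain ⟨n, hn⟩ := exists_lengthLE_of_mem_ThompsonF hf
  obtain ⟨w, hwlen, hwF, hwf⟩ := lengthLE_wordLength_of_lengthLE hn
  have hupper : LengthLE A f (wordLength f * M) := by
    rw [← hwf] at hwlen ⊢
    exact (LengthLE.prod w fun x hx => hM x (hwF x hx)).mono (Nat.mul_le_mul_right M hwlen)
  have hbad : ∀ g, LengthLE A g (wordLengthWith S f) →
      (badWords g).encard ≤ (wordLengthWith S f * K : ℕ) := by
    rintro g ⟨z, hz, hzA, rfl⟩
    exact (encard_badWords_prod_le z fun x hx => hK x (hzA x hx)).trans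
      (Nat.cast_le.2 (Nat.mul_le_mul_right K hz))
  have hS' := lengthLE_wordLengthWith_of_lengthLE hupper
  have hlow := wordLength_le
    (lengthLE_of_encard_badWords hf (hbad f hS') (hbad _ (hS'.inv hA)))
  have hup := wordLengthWith_le hupper
  have hlow' : (wordLength f : ℝ) ≤ 6 * K * wordLengthWith S f := by
    have : (wordLength f : ℝ) ≤
        3 * (wordLengthWith S f * K) + 3 * (wordLengthWith S f * K) := by
      exact_mod_cast hlow
    linarith
  have hup' : (wordLengthWith S f : ℝ) ≤ wordLength f * M := by exact_mod_cast hup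
  have hK0 : (0 : ℝ) ≤ K := K.cast_nonneg
  have hM0 : (0 : ℝ) ≤ M := M.cast_nonneg
  have hl0 : (0 : ℝ) ≤ wordLength f := Nat.cast_nonneg _
  have hS0 : (0 : ℝ) ≤ wordLengthWith S f := Nat.cast_nonneg _
  constructor
  · rw [one_div, inv_mul_le_iff₀ hCpos]
    nlinarith [mul_nonneg hM0 hS0]
  · nlinarith [mul_nonneg hK0 hl0]

end
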